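/- arXiv:2403.18212 — 2 statements merged into one kernel-verified Lean document; each statement's English description precedes it below -/
import Mathlib

section
/- For all finite words w₁, w₂ ∈ α*: MP(w₁) = MP(w₂) (i.e., w₁ ∼ w₂) if and only if the product states v(w₁) and v(w₂) are mutually Z-reachable, i.e., each of v(w₁), v(w₂) is reachable from the other under the reflexive-transitive closure of Z (equivalently, they lie in the same strongly connected component of the graph with edge relation Z). -/
section PDFA

variable {α : Type*} [Fintype α] {ι : Type*} [Fintype ι] [PartialOrder ι]
  {σ : ι → Type*}

/-- The product state reached by reading the word `w` in all DFAs simultaneously. -/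
def vstate (A : ∀ i, DFA α (σ i)) (w : List α) : ∀ i, σ i :=
  fun i => (A i).eval w

/-- The set of (indices of) formulas satisfied by the word `w`. -/
def Sat (A : ∀ i, DFA α (σ i)) (w : List α) : Set ι :=
  {i | (A i).eval w ∈ (A i).accept}

/-- The most-preferred (⊵-maximal) formulas satisfied by the word `w`. -/
def MPw (A : ∀ i, DFA α (σ i)) (w : List α) : Set ι :=
  {i ∈ Sat A w | ¬ ∃ j ∈ Sat A w, i < j}

/-- The set of (indices of) formulas accepted at the product state `b`. -/
def AccSet (A : ∀ i, DFA α (σ i)) (b : ∀ i, σ i) : Set ι :=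
  {i | b i ∈ (A i).accept}

/-- The most-preferred (⊵-maximal) formulas accepted at the product state `b`. -/
def MPs (A : ∀ i, DFA α (σ i)) (b : ∀ i, σ i) : Set ι :=
  {i ∈ AccSet A b | ¬ ∃ j ∈ AccSet A b, i < j}

/-- The edge relation of Algorithm 1 on product states: `Zrel A a b` iff every
`i ∈ MPs b` is weakly preferred to some `j ∈ MPs a`. -/
def Zrel (A : ∀ i, DFA α (σ i)) (a b : ∀ i, σ i) : Prop :=
  ∀ i ∈ MPs A b, ∃ j ∈ MPs A a, j ≤ i

theorem MPs_isAntichain (A : ∀ i, DFA α (σ i)) (b : ∀ i, σ i) :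
    IsAntichain (· ≤ ·) (MPs A b) :=
  fun _ hi j hj hne hle => hi.2 ⟨j, hj.1, lt_of_le_of_ne hle hne⟩

theorem Zrel_refl (A : ∀ i, DFA α (σ i)) (a : ∀ i, σ i) : Zrel A a a :=
  fun i hi => ⟨i, hi, le_rfl⟩

theorem Zrel.trans {A : ∀ i, DFA α (σ i)} {a b c : ∀ i, σ i}
    (hab : Zrel A a b) (hbc : Zrel A b c) : Zrel A a c := by
  intro i hi
  obtain ⟨j, hj, hji⟩ := hbc i hi
  obtain ⟨k, hk, hkj⟩ := hab j hj
  exact ⟨k, hk, hkj.trans hji⟩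

theorem reflTransGen_Zrel_iff {A : ∀ i, DFA α (σ i)} {a b : ∀ i, σ i} :
    Relation.ReflTransGen (Zrel A) a b ↔ Zrel A a b := by
  refine ⟨fun h => ?_, .single⟩
  induction h with
  | refl => exact Zrel_refl A a
  | tail _ hbc ih => exact ih.trans hbc

theorem MPs_subset_of_Zrel {A : ∀ i, DFA α (σ i)} {a b : ∀ i, σ i}
    (hab : Zrel A a b) (hba : Zrel A b a) : MPs A b ⊆ MPs A a := by
  intro i hi
  obtain ⟨j, hj, hji⟩ := hab i hi
  obtain ⟨k, hk, hkj⟩ := hba j hj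
  obtain rfl : k = i := (MPs_isAntichain A b).eq hk hi (hkj.trans hji)
  rwa [← le_antisymm hji hkj]

theorem MPs_eq_iff {A : ∀ i, DFA α (σ i)} {a b : ∀ i, σ i} :
    MPs A a = MPs A b ↔ Zrel A a b ∧ Zrel A b a := by
  refine ⟨fun h => ?_, fun ⟨hab, hba⟩ =>
    (MPs_subset_of_Zrel hba hab).antisymm (MPs_subset_of_Zrel hab hba)⟩
  exact ⟨fun i hi => ⟨i, h ▸ hi, le_rfl⟩, fun i hi => ⟨i, h ▸ hi, le_rfl⟩⟩

/-- `MP(w₁) = MP(w₂)` (i.e. `w₁ ∼ w₂`) iff the product states `v(w₁)` and `v(w₂)` are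
mutually `Z`-reachable, i.e. lie in the same strongly connected component. -/
theorem indifferent_iff_same_scc (A : ∀ i, DFA α (σ i)) (w₁ w₂ : List α) :
    MPw A w₁ = MPw A w₂ ↔
      (Relation.ReflTransGen (Zrel A) (vstate A w₁) (vstate A w₂) ∧
        Relation.ReflTransGen (Zrel A) (vstate A w₂) (vstate A w₁)) := by
  simp only [reflTransGen_Zrel_iff]
  exact MPs_eq_iff

end PDFA
end

section
/- (Strong-ordering core of the Pareto theorem.) Let 𝒫 be a set of probability mass functions on U and P ∈ 𝒫. Suppose P is Pareto optimal for the finitely many objectives indexed by the upper sets of Y, i.e., there is no P' ∈ 𝒫 with P'(f⁻¹(T)) ≥ P(f⁻¹(T)) for every upper set T ⊆ Y and P'(f⁻¹(T)) > P(f⁻¹(T)) for at least one upper set T ⊆ Y. Then P is strong-stochastic nondominated in 𝒫: there is no P' ∈ 𝒫 with P'(S) ≥ P(S) for every upper set S ⊆ U and P'(S) > P(S) for at least one upper set S ⊆ U. -/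
/-- `S ⊆ U` is an upper (increasing) set w.r.t. the preorder pulled back along
`f : U → Y` (`u' ⪰ u` iff `f u ≤ f u'`). -/
def UpperU {U Y : Type*} [Preorder Y] (f : U → Y) (S : Set U) : Prop :=
  ∀ ⦃u u' : U⦄, u ∈ S → f u ≤ f u' → u' ∈ S

/-- Every upper set for the pulled-back preorder is the preimage of an upper set. -/
theorem UpperU.exists_isUpperSet_preimage_eq {U Y : Type*} [Preorder Y] {f : U → Y}
    {S : Set U} (hS : UpperU f S) : ∃ T : Set Y, IsUpperSet T ∧ f ⁻¹' T = S := by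
  refine ⟨upperClosure (f '' S), (upperClosure (f '' S)).upper, ?_⟩
  ext u
  constructor
  · rintro ⟨_, ⟨v, hv, rfl⟩, hvu⟩
    exact hS hv hvu
  · intro hu
    exact subset_upperClosure ⟨u, hu, rfl⟩

/-- Strong-ordering core of the Pareto theorem: if `P ∈ Ps` is Pareto optimal for the
objectives indexed by upper sets of `Y`, then `P` is strong-stochastic nondominated
in `Ps`. -/
theorem pareto_implies_strong_nondominated {U Y : Type*} [Preorder Y] [Fintype Y]
    (f : U → Y) (Ps : Set (PMF U)) (P : PMF U) (hP : P ∈ Ps)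
    (hpareto : ¬ ∃ P' ∈ Ps,
      (∀ T : Set Y, IsUpperSet T →
          P.toOuterMeasure (f ⁻¹' T) ≤ P'.toOuterMeasure (f ⁻¹' T)) ∧
        (∃ T : Set Y, IsUpperSet T ∧
          P.toOuterMeasure (f ⁻¹' T) < P'.toOuterMeasure (f ⁻¹' T))) :
    ¬ ∃ P' ∈ Ps,
      (∀ S : Set U, UpperU f S → P.toOuterMeasure S ≤ P'.toOuterMeasure S) ∧
        (∃ S : Set U, UpperU f S ∧ P.toOuterMeasure S < P'.toOuterMeasure S) := by
  rintro ⟨P', hP', hle, S, hS, hlt⟩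
  obtain ⟨T, hT, rfl⟩ := hS.exists_isUpperSet_preimage_eq
  exact hpareto ⟨P', hP', fun T' hT' => hle _ fun _ _ hu huu' => hT' huu' hu, T, hT, hlt⟩
end
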